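/- Let 0 < λ ≤ Λ and let N ≥ 2 be an integer with Ñ := (λ/Λ)(N−1) + 1 > 2. Assume p⋆ > 1 is an exponent for which the Dirichlet problem in the unit ball with exponent p⋆ admits no positive radial solution. Let εₙ → 0⁺ with pₙ := p⋆ − εₙ > 1, and for each n let uₙ be a positive radial solution of the Dirichlet problem with exponent pₙ. Then Mₙ := uₙ(0) = ‖uₙ‖_∞ → +∞ as n → ∞. -/

import Mathlib

open Real Filter Set

/-- The radial Pucci maximal operator `M⁺_{λ,Λ}` applied to a radial C² function `u`
of the radial variable `r`. -/
noncomputable def radialPucci (lam Lam : ℝ) (N : ℕ) (u : ℝ → ℝ) (r : ℝ) : ℝ :=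
  Lam * max (deriv (deriv u) r) 0 + lam * min (deriv (deriv u) r) 0 +
    ((N : ℝ) - 1) * (Lam * max (deriv u r / r) 0 + lam * min (deriv u r / r) 0)

/-- A positive radial solution of the Dirichlet problem `-M⁺[u] = u^q` in the unit ball. -/
def IsDirichletSol (lam Lam : ℝ) (N : ℕ) (q : ℝ) (u : ℝ → ℝ) : Prop :=
  ContDiffOn ℝ 2 u (Set.Icc 0 1) ∧
    (∀ r ∈ Set.Ico (0 : ℝ) 1, 0 < u r) ∧
    u 1 = 0 ∧ deriv u 0 = 0 ∧
    (∀ r ∈ Set.Icc (0 : ℝ) 1, deriv u r ≤ 0) ∧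
    (∀ r ∈ Set.Ioo (0 : ℝ) 1, -radialPucci lam Lam N u r = u r ^ q)

/-- `r0 ∈ (0,1)` is the (unique) inflection radius of `u` in the unit ball. -/
def InflectionAt (u : ℝ → ℝ) (r0 : ℝ) : Prop :=
  r0 ∈ Set.Ioo (0 : ℝ) 1 ∧
    (∀ r ∈ Set.Ico (0 : ℝ) r0, deriv (deriv u) r < 0) ∧
    deriv (deriv u) r0 = 0 ∧
    (∀ r ∈ Set.Ioo r0 (1 : ℝ), 0 < deriv (deriv u) r)

/-- A normalized fast-decaying entire radial solution of `-M⁺[U] = U^{p⋆}` in `ℝ^N`,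
with fast-decay constant `c1` and inflection radius `R0`. -/
def IsEntireSol (lam Lam : ℝ) (N : ℕ) (Ntil pstar c1 R0 : ℝ) (U : ℝ → ℝ) : Prop :=
  ContDiffOn ℝ 2 U (Set.Ici 0) ∧
    (∀ r : ℝ, 0 ≤ r → 0 < U r) ∧ U 0 = 1 ∧ deriv U 0 = 0 ∧
    (∀ r : ℝ, 0 < r → deriv U r < 0) ∧
    (∀ r : ℝ, 0 < r → -radialPucci lam Lam N U r = U r ^ pstar) ∧
    0 < R0 ∧
    (∀ r ∈ Set.Ico (0 : ℝ) R0, deriv (deriv U) r < 0) ∧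
    deriv (deriv U) R0 = 0 ∧
    (∀ r : ℝ, R0 < r → 0 < deriv (deriv U) r) ∧
    0 < c1 ∧
    Filter.Tendsto (fun r : ℝ => r ^ (Ntil - 2) * U r) Filter.atTop (nhds c1) ∧
    Filter.Tendsto (fun r : ℝ => r ^ (Ntil - 1) * deriv U r) Filter.atTop
      (nhds (-(Ntil - 2) * c1))

/-- The inverse of the increasing function `x ↦ Λ x⁺ - λ x⁻`. -/
noncomputable def pucciInv (lam Lam s : ℝ) : ℝ := min (s / Lam) (s / lam)

section PucciInv

variable {lam Lam : ℝ}

theorem eq_pucciInv_iff (hlam : 0 < lam) (hlL : lam ≤ Lam) {x s : ℝ} :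
    x = pucciInv lam Lam s ↔ Lam * max x 0 + lam * min x 0 = s := by
  have hLam : 0 < Lam := hlam.trans_le hlL
  unfold pucciInv
  rcases le_total 0 s with hs | hs
  · have h1 : s / Lam ≤ s / lam := by gcongr
    rw [min_eq_left h1, eq_div_iff hLam.ne']
    rcases le_total 0 x with hx | hx
    · rw [max_eq_left hx, min_eq_right hx, mul_comm]; simp
    · rw [max_eq_right hx, min_eq_left hx]
      constructor <;> intro h <;> nlinarith
  · have h1 : s / lam ≤ s / Lam := by
      rw [div_le_div_iff₀ hlam hLam]; nlinarith
    rw [min_eq_right h1, eq_div_iff hlam.ne']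
    rcases le_total 0 x with hx | hx
    · rw [max_eq_left hx, min_eq_right hx]
      constructor <;> intro h <;> nlinarith
    · rw [max_eq_right hx, min_eq_left hx, mul_comm]; simp

theorem continuous_pucciInv : Continuous (pucciInv lam Lam) := by
  unfold pucciInv; fun_prop

theorem pucciInv_le (s : ℝ) : pucciInv lam Lam s ≤ s / lam := min_le_right _ _

theorem div_le_pucciInv (hlam : 0 < lam) (hlL : lam ≤ Lam) {s t : ℝ} (ht : t ≤ 0) (hts : t ≤ s) :
    t / lam ≤ pucciInv lam Lam s := by
  have hLam : 0 < Lam := hlam.trans_le hlL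
  refine le_min ?_ (by gcongr)
  calc t / lam ≤ t / Lam := by rw [div_le_div_iff₀ hlam hLam]; nlinarith
    _ ≤ s / Lam := by gcongr

theorem mul_pucciInv {r : ℝ} (hr : 0 ≤ r) (s : ℝ) :
    r * pucciInv lam Lam s = pucciInv lam Lam (r * s) := by
  unfold pucciInv
  rw [mul_min_of_nonneg _ _ hr, mul_div_assoc, mul_div_assoc]

theorem abs_pucciInv_sub_le (hlam : 0 < lam) (hlL : lam ≤ Lam) (s t : ℝ) :
    |pucciInv lam Lam s - pucciInv lam Lam t| ≤ |s - t| / lam := by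
  have hLam : 0 < Lam := hlam.trans_le hlL
  refine (abs_min_sub_min_le_max _ _ _ _).trans (max_le ?_ ?_)
  · rw [← sub_div, abs_div, abs_of_pos hLam]; gcongr
  · rw [← sub_div, abs_div, abs_of_pos hlam]

theorem pucciInv_of_nonpos (hlam : 0 < lam) (hlL : lam ≤ Lam) {s : ℝ} (hs : s ≤ 0) :
    pucciInv lam Lam s = s / lam :=
  le_antisymm (pucciInv_le s) (div_le_pucciInv hlam hlL hs le_rfl)

theorem pucciInv_eq_zero (hlam : 0 < lam) (hlL : lam ≤ Lam) {s : ℝ}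
    (hs : pucciInv lam Lam s = 0) : s = 0 := by
  have := (eq_pucciInv_iff hlam hlL).1 hs.symm
  simpa using this.symm

end PucciInv

/-- `u` solves the radial Dirichlet problem in dimension `k + 2`, with first and second
derivatives `a` and `b` up to the boundary and with the equation solved for `b`. -/
structure IsRegularSol (lam Lam : ℝ) (k : ℕ) (q : ℝ) (u a b : ℝ → ℝ) : Prop where
  hasDeriv : ∀ r ∈ Icc (0 : ℝ) 1, HasDerivWithinAt u (a r) (Icc 0 1) r
  hasDeriv₂ : ∀ r ∈ Icc (0 : ℝ) 1, HasDerivWithinAt a (b r) (Icc 0 1) r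
  cont : ContinuousOn b (Icc 0 1)
  nonneg : ∀ r ∈ Icc (0 : ℝ) 1, 0 ≤ u r
  zero_right : u 1 = 0
  nonpos : ∀ r ∈ Icc (0 : ℝ) 1, a r ≤ 0
  zero_left : a 0 = 0
  eqn : ∀ r ∈ Ioc (0 : ℝ) 1,
    b r = pucciInv lam Lam (-u r ^ q - lam * (k + 1) * (a r / r))

theorem radialPucci_eq_iff {lam Lam : ℝ} (hlam : 0 < lam) (hlL : lam ≤ Lam) {k : ℕ}
    {u : ℝ → ℝ} {r c : ℝ} (hr : 0 < r) (hu : deriv u r ≤ 0) :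
    -radialPucci lam Lam (k + 2) u r = c ↔
      deriv (deriv u) r = pucciInv lam Lam (-c - lam * (k + 1) * (deriv u r / r)) := by
  have h : deriv u r / r ≤ 0 := div_nonpos_of_nonpos_of_nonneg hu hr.le
  rw [eq_pucciInv_iff hlam hlL, radialPucci, max_eq_right h, min_eq_left h]
  push_cast
  constructor <;> intro h <;> linear_combination -h

theorem IsDirichletSol.exists_isRegularSol {lam Lam : ℝ} (hlam : 0 < lam) (hlL : lam ≤ Lam)
    {k : ℕ} {q : ℝ} (hq : 1 < q) {u : ℝ → ℝ} (h : IsDirichletSol lam Lam (k + 2) q u) :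
    ∃ a b, IsRegularSol lam Lam k q u a b := by
  obtain ⟨hC, hpos, h1, -, hle, heq⟩ := h
  have hU : UniqueDiffOn ℝ (Icc (0 : ℝ) 1) := uniqueDiffOn_Icc one_pos
  set a := derivWithin u (Icc 0 1) with ha
  set b := derivWithin a (Icc 0 1) with hb
  have hCa : ContDiffOn ℝ 1 a (Icc 0 1) := hC.derivWithin hU (by norm_num)
  obtain ⟨hda, hcb⟩ := (contDiffOn_one_iff_derivWithin hU).1 hCa
  have hdu : DifferentiableOn ℝ u (Icc 0 1) := hC.differentiableOn (by norm_num)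
  have hau : ∀ r ∈ Ioo (0 : ℝ) 1, a r = deriv u r := fun r hr =>
    derivWithin_of_mem_nhds (Icc_mem_nhds hr.1 hr.2)
  have hbu : ∀ r ∈ Ioo (0 : ℝ) 1, b r = deriv (deriv u) r := fun r hr => by
    rw [hb, derivWithin_of_mem_nhds (Icc_mem_nhds hr.1 hr.2)]
    apply Filter.EventuallyEq.deriv_eq
    filter_upwards [Ioo_mem_nhds hr.1 hr.2] with s hs using hau s hs
  have hcl : Icc (0 : ℝ) 1 ⊆ closure (Ioo 0 1) := by rw [closure_Ioo zero_ne_one]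
  have hueq : ContinuousOn (fun r => u r ^ q) (Icc 0 1) := fun r hr =>
    (hdu.continuousOn r hr).rpow continuousWithinAt_const (Or.inr (by linarith))
  have hac : ContinuousOn a (Icc 0 1) := hda.continuousOn
  have key : EqOn (fun r => r * b r)
      (fun r => pucciInv lam Lam (r * -u r ^ q - lam * (k + 1) * a r)) (Icc 0 1) := by
    refine Set.EqOn.of_subset_closure (s := Ioo 0 1) ?_ (continuousOn_id.mul hcb) ?_
      Ioo_subset_Icc_self hcl
    · intro r hr
      have := (radialPucci_eq_iff hlam hlL hr.1 (hle r (Ioo_subset_Icc_self hr))).1 (heq r hr)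
      have hr0 : r ≠ 0 := hr.1.ne'
      simp only
      rw [hbu r hr, hau r hr, this, mul_pucciInv hr.1.le]
      congr 1
      field_simp
    · exact continuous_pucciInv.comp_continuousOn
        ((continuousOn_id.mul hueq.neg).sub (continuousOn_const.mul hac))
  refine ⟨a, b, fun r hr => (hdu r hr).hasDerivWithinAt, fun r hr => (hda r hr).hasDerivWithinAt,
    hcb, ?_, h1, ?_, ?_, ?_⟩
  · intro r hr
    rcases hr.2.eq_or_lt with h | h
    · rw [h, h1]
    · exact (hpos r ⟨hr.1, h⟩).le
  · intro r hr
    refine le_on_closure (f := a) (g := fun _ => 0) (s := Ioo 0 1) (fun s hs => ?_) ?_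
      continuousOn_const (hcl hr)
    · exact (hau s hs).le.trans (hle s (Ioo_subset_Icc_self hs))
    · rwa [closure_Ioo zero_ne_one]
  · have := key (left_mem_Icc.2 zero_le_one)
    simp only [zero_mul, zero_sub] at this
    have := pucciInv_eq_zero hlam hlL this.symm
    have h2 : lam * ((k : ℝ) + 1) ≠ 0 := by positivity
    simpa [h2, neg_eq_zero, mul_eq_zero, hlam.ne'] using this
  · intro r hr
    have h0 : r ≠ 0 := hr.1.ne'
    have := key (Ioc_subset_Icc_self hr)
    refine mul_left_cancel₀ h0 (this.trans ?_)
    rw [mul_pucciInv hr.1.le]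
    field_simp

theorem IsRegularSol.isDirichletSol {lam Lam : ℝ} (hlam : 0 < lam) (hlL : lam ≤ Lam)
    {k : ℕ} {q : ℝ} {u a b : ℝ → ℝ} (h : IsRegularSol lam Lam k q u a b)
    (hpos : ∀ r ∈ Ico (0 : ℝ) 1, 0 < u r) : IsDirichletSol lam Lam (k + 2) q u := by
  have hU : UniqueDiffOn ℝ (Icc (0 : ℝ) 1) := uniqueDiffOn_Icc one_pos
  have hau : ∀ r ∈ Ioo (0 : ℝ) 1, deriv u r = a r := fun r hr =>
    ((h.hasDeriv r (Ioo_subset_Icc_self hr)).hasDerivAt (Icc_mem_nhds hr.1 hr.2)).deriv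
  have hbu : ∀ r ∈ Ioo (0 : ℝ) 1, deriv (deriv u) r = b r := fun r hr => by
    rw [← ((h.hasDeriv₂ r (Ioo_subset_Icc_self hr)).hasDerivAt (Icc_mem_nhds hr.1 hr.2)).deriv]
    apply Filter.EventuallyEq.deriv_eq
    filter_upwards [Ioo_mem_nhds hr.1 hr.2] with s hs using hau s hs
  have hda : EqOn (derivWithin u (Icc 0 1)) a (Icc 0 1) := fun r hr =>
    (h.hasDeriv r hr).derivWithin (hU r hr)
  have hdiff : ∀ r ∈ Icc (0 : ℝ) 1, deriv u r = a r ∨ deriv u r = 0 := by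
    intro r hr
    by_cases hd : DifferentiableAt ℝ u r
    · exact Or.inl ((hd.derivWithin (hU r hr)).symm.trans (hda hr))
    · exact Or.inr (deriv_zero_of_not_differentiableAt hd)
  have hle : ∀ r ∈ Icc (0 : ℝ) 1, deriv u r ≤ 0 := by
    intro r hr
    rcases hdiff r hr with h' | h'
    · exact h'.le.trans (h.nonpos r hr)
    · exact h'.le
  refine ⟨?_, hpos, h.zero_right, ?_, hle, ?_⟩
  · rw [show (2 : WithTop ℕ∞) = 1 + 1 by norm_num, contDiffOn_succ_iff_derivWithin hU]
    refine ⟨fun r hr => (h.hasDeriv r hr).differentiableWithinAt, by simp, ?_⟩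
    refine ContDiffOn.congr ?_ hda
    rw [contDiffOn_one_iff_derivWithin hU]
    exact ⟨fun r hr => (h.hasDeriv₂ r hr).differentiableWithinAt,
      h.cont.congr fun r hr => (h.hasDeriv₂ r hr).derivWithin (hU r hr)⟩
  · rcases hdiff 0 (left_mem_Icc.2 zero_le_one) with h' | h'
    · exact h'.trans h.zero_left
    · exact h'
  · intro r hr
    have hr' := Ioo_subset_Icc_self hr
    rw [radialPucci_eq_iff hlam hlL hr.1 (hle r hr'), hbu r hr, hau r hr]
    exact h.eqn r (Ioo_subset_Ioc_self hr)

namespace IsRegularSol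

variable {lam Lam : ℝ} {k : ℕ} {q : ℝ} {u a b : ℝ → ℝ}

theorem antitoneOn (h : IsRegularSol lam Lam k q u a b) : AntitoneOn u (Icc 0 1) :=
  antitoneOn_of_hasDerivWithinAt_nonpos (convex_Icc 0 1)
    (fun r hr => (h.hasDeriv r hr).continuousWithinAt)
    (fun r hr => (h.hasDeriv r (interior_subset hr)).mono interior_subset)
    (fun r hr => h.nonpos r (interior_subset hr))

theorem le_left (h : IsRegularSol lam Lam k q u a b) {r : ℝ} (hr : r ∈ Icc (0 : ℝ) 1) :
    u r ≤ u 0 :=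
  h.antitoneOn (left_mem_Icc.2 zero_le_one) hr hr.1

theorem laplacian_le (hlam : 0 < lam) (h : IsRegularSol lam Lam k q u a b) {r : ℝ}
    (hr : r ∈ Ioc (0 : ℝ) 1) : b r + (k + 1) * (a r / r) ≤ -(u r ^ q / lam) := by
  have h1 := pucciInv_le (lam := lam) (Lam := Lam) (-u r ^ q - lam * (k + 1) * (a r / r))
  rw [← h.eqn r hr] at h1
  have h2 : (-u r ^ q - lam * (k + 1) * (a r / r)) / lam
      = -(u r ^ q / lam) - (k + 1) * (a r / r) := by field_simp
  linarith

/-- Integrating the differential inequality `(r ^ (N - 1) a)' ≤ -c r ^ (N - 1)`. -/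
theorem antitoneOn_flux_add (hlam : 0 < lam) (h : IsRegularSol lam Lam k q u a b) {R c : ℝ}
    (hR : R ∈ Icc (0 : ℝ) 1) (hc : ∀ r ∈ Ioo 0 R, c ≤ u r ^ q / lam) :
    AntitoneOn (fun r => r ^ (k + 1) * a r + c / (k + 2) * r ^ (k + 2)) (Icc 0 R) := by
  have hsub : Icc 0 R ⊆ Icc (0 : ℝ) 1 := Icc_subset_Icc_right hR.2
  have hd : ∀ r ∈ Icc 0 R, HasDerivWithinAt
      (fun r => r ^ (k + 1) * a r + c / (k + 2) * r ^ (k + 2))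
      ((k + 1) * r ^ k * a r + r ^ (k + 1) * b r + c * r ^ (k + 1)) (Icc 0 R) r := by
    intro r hr
    have h1 := (hasDerivWithinAt_pow (s := Icc 0 R) (k + 1) r).mul ((h.hasDeriv₂ r (hsub hr)).mono hsub)
    have h2 := (hasDerivWithinAt_pow (s := Icc 0 R) (k + 2) r).const_mul (c / ((k : ℝ) + 2))
    refine (h1.add h2).congr_deriv ?_
    push_cast
    field_simp
  refine antitoneOn_of_hasDerivWithinAt_nonpos (convex_Icc 0 R)
    (fun r hr => (hd r hr).continuousWithinAt)
    (fun r hr => (hd r (interior_subset hr)).mono interior_subset) (fun r hr => ?_)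
  rw [interior_Icc] at hr
  have h1 := h.laplacian_le hlam ⟨hr.1, hr.2.le.trans hR.2⟩
  have h2 := hc r hr
  have hr0 : r ≠ 0 := hr.1.ne'
  have h3 : (k + 1) * r ^ k * a r + r ^ (k + 1) * b r + c * r ^ (k + 1)
      = r ^ (k + 1) * (b r + (k + 1) * (a r / r) + c) := by field_simp; ring
  rw [h3]
  exact mul_nonpos_of_nonneg_of_nonpos (by have := hr.1; positivity) (by linarith)

theorem deriv_le (hlam : 0 < lam) (hq : 0 ≤ q) (h : IsRegularSol lam Lam k q u a b) {r : ℝ}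
    (hr : r ∈ Ioc (0 : ℝ) 1) : a r / r ≤ -(u r ^ q / (lam * (k + 2))) := by
  have hr' := Ioc_subset_Icc_self hr
  have h1 := h.antitoneOn_flux_add hlam hr' (c := u r ^ q / lam) (fun s hs => by
    have hs' : s ∈ Icc (0 : ℝ) 1 := ⟨hs.1.le, hs.2.le.trans hr.2⟩
    have := h.antitoneOn hs' hr' hs.2.le
    have := h.nonneg r hr'
    gcongr) (left_mem_Icc.2 hr.1.le) (right_mem_Icc.2 hr.1.le) hr.1.le
  simp only [ne_eq, Nat.add_eq_zero_iff, one_ne_zero, and_false, not_false_eq_true, zero_pow,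
    zero_mul, OfNat.ofNat_ne_zero, mul_zero, add_zero] at h1
  have hr0 := hr.1
  have h2 : r ^ (k + 1) * a r + u r ^ q / lam / (k + 2) * r ^ (k + 2)
      = r ^ (k + 2) * (a r / r + u r ^ q / (lam * (k + 2))) := by
    field_simp
    ring
  rw [h2] at h1
  have h3 : 0 < r ^ (k + 2) := by positivity
  have := nonpos_of_mul_nonpos_right h1 h3
  linarith

theorem le_deriv₂ (hlam : 0 < lam) (hlL : lam ≤ Lam) (hq : 0 ≤ q)
    (h : IsRegularSol lam Lam k q u a b) {r : ℝ}
    (hr : r ∈ Ioc (0 : ℝ) 1) : -(u r ^ q / (lam * (k + 2))) ≤ b r := by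
  have h1 := h.deriv_le hlam hq hr
  have h0 : 0 ≤ u r ^ q := rpow_nonneg (h.nonneg r (Ioc_subset_Icc_self hr)) _
  have h2 : -(u r ^ q / (k + 2)) ≤ -u r ^ q - lam * (k + 1) * (a r / r) := by
    have h3 : lam * (k + 1) * (a r / r) ≤ lam * (k + 1) * -(u r ^ q / (lam * (k + 2))) := by
      gcongr
    have h4 : lam * (k + 1) * -(u r ^ q / (lam * (k + 2))) = -u r ^ q + u r ^ q / (k + 2) := by
      field_simp
      ring
    linarith
  have h3 := div_le_pucciInv hlam hlL (by simpa using by positivity) h2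
  rw [← h.eqn r hr] at h3
  refine le_trans (le_of_eq ?_) h3
  field_simp

theorem le_deriv (hlam : 0 < lam) (hlL : lam ≤ Lam) (hq : 0 ≤ q)
    (h : IsRegularSol lam Lam k q u a b) {r : ℝ}
    (hr : r ∈ Icc (0 : ℝ) 1) : -(u 0 ^ q / (lam * (k + 2))) * r ≤ a r := by
  set D := u 0 ^ q / (lam * (k + 2)) with hD
  have hd : ∀ r ∈ Icc (0 : ℝ) 1, HasDerivWithinAt (fun r => a r + D * r) (b r + D) (Icc 0 1) r := by
    intro r hr
    exact ((h.hasDeriv₂ r hr).add ((hasDerivWithinAt_id r _).const_mul D)).congr_deriv (by simp)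
  have := monotoneOn_of_hasDerivWithinAt_nonneg (convex_Icc 0 1)
    (fun r hr => (hd r hr).continuousWithinAt)
    (fun r hr => (hd r (interior_subset hr)).mono interior_subset) (fun r hr => ?_)
    (left_mem_Icc.2 zero_le_one) hr hr.1
  · simp only [h.zero_left] at this
    linarith
  · rw [interior_Icc] at hr
    have h1 := h.le_deriv₂ hlam hlL hq (Ioo_subset_Ioc_self hr)
    have h2 : u r ^ q / (lam * (k + 2)) ≤ D := by
      have := h.nonneg r (Ioo_subset_Icc_self hr)
      have := h.le_left (Ioo_subset_Icc_self hr)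
      rw [hD]
      gcongr
    linarith

theorem abs_deriv₂_le (hlam : 0 < lam) (hlL : lam ≤ Lam) (hq : 0 ≤ q)
    (h : IsRegularSol lam Lam k q u a b) {r : ℝ}
    (hr : r ∈ Icc (0 : ℝ) 1) : |b r| ≤ u 0 ^ q / lam := by
  have hcl : closure (Ioo (0 : ℝ) 1) = Icc 0 1 := closure_Ioo zero_ne_one
  refine le_on_closure (f := fun r => |b r|) (g := fun _ => u 0 ^ q / lam) (s := Ioo 0 1)
    (fun r hr => ?_) (hcl ▸ h.cont.abs) continuousOn_const (hcl ▸ hr)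
  have hr' := Ioo_subset_Icc_self hr
  have hu0 := h.nonneg r hr'
  have hu := h.le_left hr'
  have h0 : 0 ≤ u r ^ q := rpow_nonneg hu0 _
  have h1 := h.le_deriv₂ hlam hlL hq (Ioo_subset_Ioc_self hr)
  have h2 := h.laplacian_le hlam (Ioo_subset_Ioc_self hr)
  have h3 := h.le_deriv hlam hlL hq hr'
  have hqq : u r ^ q ≤ u 0 ^ q := by gcongr
  rw [← le_div_iff₀ hr.1] at h3
  have h4 : u r ^ q / (lam * (k + 2)) ≤ u 0 ^ q / lam := by
    have := h0.trans hqq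
    gcongr
    nlinarith [mul_nonneg hlam.le (Nat.cast_nonneg k : (0 : ℝ) ≤ k)]
  have h5 : ((k : ℝ) + 1) * -(u 0 ^ q / (lam * (k + 2))) ≤ (k + 1) * (a r / r) := by gcongr
  have h6 : ((k : ℝ) + 1) * -(u 0 ^ q / (lam * (k + 2)))
      = -(u 0 ^ q / lam) + u 0 ^ q / (lam * (k + 2)) := by
    field_simp
    ring
  have h7 : 0 ≤ u 0 ^ q / (lam * (k + 2)) := by
    have := h0.trans hqq
    positivity
  have h8 : 0 ≤ u r ^ q / lam := by positivity
  exact abs_le.2 ⟨by linarith, by linarith⟩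

theorem abs_deriv_le (hlam : 0 < lam) (hlL : lam ≤ Lam) (hq : 0 ≤ q)
    (h : IsRegularSol lam Lam k q u a b) {r : ℝ}
    (hr : r ∈ Icc (0 : ℝ) 1) : |a r| ≤ u 0 ^ q / (lam * (k + 2)) := by
  have h0 : 0 ≤ u 0 ^ q := rpow_nonneg (h.nonneg 0 (left_mem_Icc.2 zero_le_one)) _
  have h1 := h.le_deriv hlam hlL hq hr
  have h2 := h.nonpos r hr
  have h3 : 0 ≤ u 0 ^ q / (lam * (k + 2)) := by positivity
  refine abs_le.2 ⟨?_, by linarith⟩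
  nlinarith [hr.2]

theorem left_le (hlam : 0 < lam) (hlL : lam ≤ Lam) (hq : 0 ≤ q)
    (h : IsRegularSol lam Lam k q u a b) : u 0 ≤ u 0 ^ q / (lam * (k + 2)) := by
  have h1 := Convex.norm_image_sub_le_of_norm_hasDerivWithin_le h.hasDeriv
    (fun r hr => h.abs_deriv_le hlam hlL hq hr) (convex_Icc 0 1)
    (left_mem_Icc.2 zero_le_one) (right_mem_Icc.2 zero_le_one)
  simpa [h.zero_right, abs_of_nonneg (h.nonneg 0 (left_mem_Icc.2 zero_le_one))] using h1

/-- A solution that is positive at the origin is positive up to the boundary. -/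
theorem pos_of_pos_left (hlam : 0 < lam) (h : IsRegularSol lam Lam k q u a b)
    (h0 : 0 < u 0) {r : ℝ} (hr : r ∈ Ico (0 : ℝ) 1) : 0 < u r := by
  have hr' := Ico_subset_Icc_self hr
  refine (h.nonneg r hr').lt_of_ne fun hz => ?_
  have hrpos : 0 < r := hr.1.lt_of_ne fun h' => by rw [h', ← hz] at h0; exact hr.1.not_gt h0
  have hmem : ∀ {s}, s ∈ Ico r 1 → s ∈ Icc (0 : ℝ) 1 := fun hs => ⟨hr.1.trans hs.1, hs.2.le⟩
  have hzero : ∀ s ∈ Ico r 1, u s = 0 := fun s hs =>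
    le_antisymm (by rw [hz]; exact h.antitoneOn hr' (hmem hs) hs.1) (h.nonneg s (hmem hs))
  obtain ⟨s, hs⟩ := exists_between hr.2
  have hs' := hmem ⟨hs.1.le, hs.2⟩
  have has : a s = 0 := by
    have h1 := ((h.hasDeriv s hs').hasDerivAt (Icc_mem_nhds (hrpos.trans hs.1) hs.2)).deriv
    rw [← h1]
    have : u =ᶠ[nhds s] fun _ => 0 := by
      filter_upwards [Ioo_mem_nhds hs.1 hs.2] with t ht using hzero t ⟨ht.1.le, ht.2⟩
    rw [this.deriv_eq, deriv_const]
  have hflux := h.antitoneOn_flux_add hlam hs' (c := 0) fun t ht => by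
    have := h.nonneg t ⟨ht.1.le, ht.2.le.trans hs.2.le⟩
    positivity
  have ha0 : ∀ t ∈ Icc 0 s, a t = 0 := by
    intro t ht
    rcases ht.1.eq_or_lt with h' | h'
    · rw [← h', h.zero_left]
    · have h1 := hflux ht (right_mem_Icc.2 hs'.1) ht.2
      simp only [has, mul_zero, zero_div, zero_mul, add_zero] at h1
      have h2 : 0 < t ^ (k + 1) := by positivity
      exact le_antisymm (h.nonpos t ⟨ht.1, ht.2.trans hs'.2⟩) (nonneg_of_mul_nonneg_right h1 h2)
  have hsub : Icc 0 s ⊆ Icc (0 : ℝ) 1 := Icc_subset_Icc_right hs'.2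
  have h1 := Convex.norm_image_sub_le_of_norm_hasDerivWithin_le (C := 0)
    (fun t ht => (h.hasDeriv t (hsub ht)).mono hsub)
    (fun t ht => by simp [ha0 t ht]) (convex_Icc 0 s)
    (left_mem_Icc.2 hs'.1) (right_mem_Icc.2 hs'.1)
  rw [hzero s ⟨hs.1.le, hs.2⟩] at h1
  simp at h1
  exact h0.ne' h1

end IsRegularSol

/-- Pointwise limits of functions and of their equi-Lipschitz derivatives are compatible. -/
theorem hasDerivWithinAt_of_tendsto_of_abs_sub_le {ι : Type*} {l : Filter ι} [l.NeBot]
    {s : Set ℝ} (hs : Convex ℝ s) {f f' : ι → ℝ → ℝ} {F : ℝ → ℝ} {F' r K : ℝ} (hr : r ∈ s)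
    (hK0 : 0 ≤ K) (hf : ∀ i, ∀ t ∈ s, HasDerivWithinAt (f i) (f' i t) s t)
    (hK : ∀ i, ∀ t ∈ s, |f' i t - f' i r| ≤ K * |t - r|)
    (hF : ∀ t ∈ s, Tendsto (fun i => f i t) l (nhds (F t)))
    (hF' : Tendsto (fun i => f' i r) l (nhds F')) : HasDerivWithinAt F F' s r := by
  have key : ∀ t ∈ s, |F t - F r - (t - r) * F'| ≤ K * |t - r| * |t - r| := by
    intro t ht
    have hlim : Tendsto (fun i => |f i t - f i r - (t - r) * f' i r|) l
        (nhds |F t - F r - (t - r) * F'|) :=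
      (((hF t ht).sub (hF r hr)).sub (hF'.const_mul (t - r))).abs
    refine le_of_tendsto' hlim fun i => ?_
    have hsub : uIcc r t ⊆ s := hs.ordConnected.uIcc_subset hr ht
    have hd : ∀ x ∈ uIcc r t, HasDerivWithinAt (fun x => f i x - x * f' i r)
        (f' i x - f' i r) (uIcc r t) x := fun x hx =>
      (((hf i x (hsub hx)).mono hsub).sub
        ((hasDerivWithinAt_id x _).mul_const (f' i r))).congr_deriv (by simp)
    have h1 := Convex.norm_image_sub_le_of_norm_hasDerivWithin_le (C := K * |t - r|) hd
      (fun x hx => (hK i x (hsub hx)).trans ?_) (convex_uIcc r t) left_mem_uIcc right_mem_uIcc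
    · refine le_trans (le_of_eq ?_) h1
      rw [Real.norm_eq_abs]
      congr 1
      ring
    · have := abs_sub_left_of_mem_uIcc hx
      gcongr
  rw [hasDerivWithinAt_iff_isLittleO]
  have hO : (fun t => F t - F r - (t - r) • F') =O[nhdsWithin r s]
      fun t => (t - r) * (t - r) := by
    refine Asymptotics.IsBigO.of_bound K ?_
    filter_upwards [self_mem_nhdsWithin] with t ht
    simpa [mul_assoc] using key t ht
  refine hO.trans_isLittleO ?_
  have h0 : Tendsto (fun t => t - r) (nhdsWithin r s) (nhds 0) := by
    have : Tendsto (fun t => t - r) (nhds r) (nhds (r - r)) := by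
      exact (continuous_id.sub continuous_const).tendsto r
    rw [sub_self] at this
    exact this.mono_left nhdsWithin_le_nhds
  simpa using ((Asymptotics.isLittleO_one_iff ℝ).2 h0).mul_isBigO
    (Asymptotics.isBigO_refl (fun t => t - r) (nhdsWithin r s))

theorem exists_tendsto_hyperfilter {x : ℕ → ℝ} {K : ℝ} (hx : ∀ n, |x n| ≤ K) :
    ∃ y, Tendsto x (hyperfilter ℕ) (nhds y) := by
  obtain ⟨y, -, hy⟩ := isCompact_iff_ultrafilter_le_nhds.1 (isCompact_Icc (a := -K) (b := K))
    ((hyperfilter ℕ).map x)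
      (tendsto_principal.2 (Eventually.of_forall fun n => abs_le.1 (hx n)))
  exact ⟨y, hy⟩

theorem abs_rpow_sub_rpow_le {q C x y : ℝ} (hq : 1 ≤ q) (hx : x ∈ Icc 0 C) (hy : y ∈ Icc 0 C) :
    |x ^ q - y ^ q| ≤ q * C ^ (q - 1) * |x - y| := by
  refine Convex.norm_image_sub_le_of_norm_hasDerivWithin_le (f := fun x : ℝ => x ^ q)
    (fun t ht => (hasDerivAt_rpow_const (Or.inr hq)).hasDerivWithinAt) (fun t ht => ?_)
    (convex_Icc 0 C) hy hx
  have h1 : 0 ≤ t ^ (q - 1) := rpow_nonneg ht.1 _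
  rw [Real.norm_of_nonneg (by positivity)]
  have : t ^ (q - 1) ≤ C ^ (q - 1) := rpow_le_rpow ht.1 ht.2 (by linarith)
  gcongr

namespace IsRegularSol

variable {lam Lam : ℝ} {k : ℕ} {q : ℝ} {u a b : ℝ → ℝ}

theorem abs_deriv₂_sub_le (hlam : 0 < lam) (hlL : lam ≤ Lam) (hq : 1 ≤ q)
    (h : IsRegularSol lam Lam k q u a b) {C L δ : ℝ} (hC : u 0 ≤ C) (hδ : 0 < δ)
    (ha : ∀ r ∈ Icc (0 : ℝ) 1, |a r| ≤ L) (hb : ∀ r ∈ Icc (0 : ℝ) 1, |b r| ≤ L)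
    {s r : ℝ} (hs : s ∈ Icc δ 1) (hr : r ∈ Icc δ 1) :
    |b s - b r| ≤ (q * C ^ (q - 1) * L + lam * (k + 1) * (2 * L / δ ^ 2)) / lam * |s - r| := by
  have hs0 : 0 < s := hδ.trans_le hs.1
  have hr0 : 0 < r := hδ.trans_le hr.1
  have hs' : s ∈ Icc (0 : ℝ) 1 := ⟨hs0.le, hs.2⟩
  have hr' : r ∈ Icc (0 : ℝ) 1 := ⟨hr0.le, hr.2⟩
  have hL : 0 ≤ L := (abs_nonneg _).trans (ha r hr')
  have hC0 : 0 ≤ C := (h.nonneg 0 (left_mem_Icc.2 zero_le_one)).trans hC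
  have hu : |u s - u r| ≤ L * |s - r| :=
    Convex.norm_image_sub_le_of_norm_hasDerivWithin_le h.hasDeriv ha (convex_Icc 0 1) hr' hs'
  have haa : |a s - a r| ≤ L * |s - r| :=
    Convex.norm_image_sub_le_of_norm_hasDerivWithin_le h.hasDeriv₂ hb (convex_Icc 0 1) hr' hs'
  have h1 : |u s ^ q - u r ^ q| ≤ q * C ^ (q - 1) * L * |s - r| := by
    refine (abs_rpow_sub_rpow_le hq ⟨h.nonneg s hs', (h.le_left hs').trans hC⟩
      ⟨h.nonneg r hr', (h.le_left hr').trans hC⟩).trans ?_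
    rw [mul_assoc _ L]
    gcongr
  have h2 : |a s / s - a r / r| ≤ 2 * L / δ ^ 2 * |s - r| := by
    have e : a s / s - a r / r = ((a s - a r) * r + a r * (r - s)) / (s * r) := by
      field_simp
      ring
    rw [e, abs_div, abs_of_pos (mul_pos hs0 hr0), div_mul_eq_mul_div]
    have h3 : |(a s - a r) * r + a r * (r - s)| ≤ 2 * L * |s - r| := by
      refine (abs_add_le _ _).trans ?_
      rw [abs_mul, abs_mul, abs_of_pos hr0, abs_sub_comm r s]
      have h4 : |a s - a r| * r ≤ L * |s - r| * 1 := by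
        gcongr
        exact hr.2
      have h5 : |a r| * |s - r| ≤ L * |s - r| := by
        gcongr
        exact ha r hr'
      linarith
    have h6 : δ ^ 2 ≤ s * r := by
      rw [sq]
      exact mul_le_mul hs.1 hr.1 hδ.le hs0.le
    gcongr
  rw [h.eqn s ⟨hs0, hs.2⟩, h.eqn r ⟨hr0, hr.2⟩]
  refine (abs_pucciInv_sub_le hlam hlL _ _).trans ?_
  rw [div_mul_eq_mul_div]
  gcongr
  have e : -u s ^ q - lam * (k + 1) * (a s / s) - (-u r ^ q - lam * (k + 1) * (a r / r))
      = -(u s ^ q - u r ^ q) + -(lam * (k + 1) * (a s / s - a r / r)) := by ring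
  rw [e]
  refine (abs_add_le _ _).trans ?_
  rw [abs_neg, abs_neg, abs_mul, abs_of_pos (by positivity : 0 < lam * ((k : ℝ) + 1)), add_mul,
    mul_assoc (lam * ((k : ℝ) + 1))]
  gcongr

end IsRegularSol

/-- Bounded families of solutions with convergent exponents have limit points that are
solutions. -/
theorem exists_isRegularSol_limit {lam Lam : ℝ} (hlam : 0 < lam) (hlL : lam ≤ Lam) {k : ℕ}
    {p C : ℝ} {q : ℕ → ℝ} {u a b : ℕ → ℝ → ℝ} (hq1 : ∀ n, 1 ≤ q n) (hqp : ∀ n, q n ≤ p)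
    (hq : Tendsto q atTop (nhds p)) (hC1 : 1 ≤ C) (hC : ∀ n, u n 0 ≤ C)
    (h : ∀ n, IsRegularSol lam Lam k (q n) (u n) (a n) (b n)) :
    ∃ w v g, IsRegularSol lam Lam k p w v g ∧
      Tendsto (fun n => u n 0) (hyperfilter ℕ) (nhds (w 0)) := by
  have h0mem : (0 : ℝ) ∈ Icc (0 : ℝ) 1 := left_mem_Icc.2 zero_le_one
  have hp0 : 0 < p := one_pos.trans_le ((hq1 0).trans (hqp 0))
  have hq0 : ∀ n, 0 ≤ q n := fun n => zero_le_one.trans (hq1 n)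
  have hC0 : 0 < C := one_pos.trans_le hC1
  have hqh : Tendsto q (hyperfilter ℕ) (nhds p) := hq.mono_left Nat.hyperfilter_le_atTop
  set L := C ^ p / lam with hL
  have hL0 : 0 ≤ L := by positivity
  have hpow : ∀ n, u n 0 ^ q n ≤ C ^ p := fun n =>
    (rpow_le_rpow ((h n).nonneg 0 h0mem) (hC n) (hq0 n)).trans
      (rpow_le_rpow_of_exponent_le hC1 (hqp n))
  have hb : ∀ n, ∀ r ∈ Icc (0 : ℝ) 1, |b n r| ≤ L := fun n r hr =>
    ((h n).abs_deriv₂_le hlam hlL (hq0 n) hr).trans (by have := hpow n; rw [hL]; gcongr)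
  have ha : ∀ n, ∀ r ∈ Icc (0 : ℝ) 1, |a n r| ≤ L := fun n r hr => by
    refine ((h n).abs_deriv_le hlam hlL (hq0 n) hr).trans ?_
    rw [hL]
    gcongr
    · exact hpow n
    · nlinarith [mul_nonneg hlam.le (Nat.cast_nonneg k : (0 : ℝ) ≤ k)]
  have hw : ∀ r, ∃ y, r ∈ Icc (0 : ℝ) 1 →
      Tendsto (fun n => u n r) (hyperfilter ℕ) (nhds y) := fun r => by
    by_cases hr : r ∈ Icc (0 : ℝ) 1
    · obtain ⟨y, hy⟩ := exists_tendsto_hyperfilter (x := fun n => u n r) (K := C) fun n => by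
        rw [abs_of_nonneg ((h n).nonneg r hr)]
        exact ((h n).le_left hr).trans (hC n)
      exact ⟨y, fun _ => hy⟩
    · exact ⟨0, fun h' => absurd h' hr⟩
  have hv : ∀ r, ∃ y, r ∈ Icc (0 : ℝ) 1 →
      Tendsto (fun n => a n r) (hyperfilter ℕ) (nhds y) := fun r => by
    by_cases hr : r ∈ Icc (0 : ℝ) 1
    · obtain ⟨y, hy⟩ := exists_tendsto_hyperfilter (x := fun n => a n r) fun n => ha n r hr
      exact ⟨y, fun _ => hy⟩
    · exact ⟨0, fun h' => absurd h' hr⟩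
  choose w hw using hw
  choose v hv using hv
  set G : ℝ → ℝ := fun r => pucciInv lam Lam (-w r ^ p - lam * (k + 1) * (v r / r)) with hG
  set g0 : ℝ := -(w 0 ^ p / (lam * (k + 2))) with hg0
  set g : ℝ → ℝ := fun r => if r = 0 then g0 else G r with hg
  have hgG : ∀ r, 0 < r → g r = G r := fun r hr => if_neg hr.ne'
  have hwp : ∀ r ∈ Icc (0 : ℝ) 1,
      Tendsto (fun n => u n r ^ q n) (hyperfilter ℕ) (nhds (w r ^ p)) := fun r hr =>
    (hw r hr).rpow hqh (Or.inr hp0)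
  have hbG : ∀ r ∈ Ioc (0 : ℝ) 1, Tendsto (fun n => b n r) (hyperfilter ℕ) (nhds (G r)) := by
    intro r hr
    have hr' := Ioc_subset_Icc_self hr
    refine Tendsto.congr (fun n => ((h n).eqn r hr).symm) ?_
    exact (continuous_pucciInv.tendsto _).comp
      ((hwp r hr').neg.sub (((hv r hr').div_const r).const_mul _))
  have hv0 : v 0 = 0 := by
    refine tendsto_nhds_unique (hv 0 h0mem) ?_
    simp only [(h _).zero_left]
    exact tendsto_const_nhds
  have hdw : ∀ r ∈ Icc (0 : ℝ) 1, HasDerivWithinAt w (v r) (Icc 0 1) r := fun r hr =>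
    hasDerivWithinAt_of_tendsto_of_abs_sub_le (convex_Icc 0 1) hr hL0
      (fun n => (h n).hasDeriv)
      (fun n t ht => Convex.norm_image_sub_le_of_norm_hasDerivWithin_le (h n).hasDeriv₂ (hb n)
        (convex_Icc 0 1) hr ht) hw (hv r hr)
  have hwc : ∀ r ∈ Icc (0 : ℝ) 1, ContinuousWithinAt (fun r => w r ^ p) (Icc 0 1) r :=
    fun r hr => (hdw r hr).continuousWithinAt.rpow continuousWithinAt_const (Or.inr hp0)
  have hdv : ∀ r ∈ Ioc (0 : ℝ) 1, HasDerivWithinAt v (G r) (Icc 0 1) r := by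
    intro r hr
    have hδ : 0 < r / 2 := half_pos hr.1
    have hsub : Icc (r / 2) 1 ⊆ Icc (0 : ℝ) 1 := Icc_subset_Icc_left hδ.le
    have hrm : r ∈ Icc (r / 2) 1 := ⟨half_le_self hr.1.le, hr.2⟩
    have hd : HasDerivWithinAt v (G r) (Icc (r / 2) 1) r := by
      refine hasDerivWithinAt_of_tendsto_of_abs_sub_le
        (K := (p * C ^ p * L + lam * (k + 1) * (2 * L / (r / 2) ^ 2)) / lam) (convex_Icc _ _)
        hrm (by positivity) (fun n t ht => ((h n).hasDeriv₂ t (hsub ht)).mono hsub)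
        (fun n t ht => ?_) (fun t ht => hv t (hsub ht)) (hbG r hr)
      refine ((h n).abs_deriv₂_sub_le hlam hlL (hq1 n) (hC n) hδ (ha n) (hb n) ht hrm).trans ?_
      have h1 : C ^ (q n - 1) ≤ C ^ p :=
        rpow_le_rpow_of_exponent_le hC1 (by linarith [hqp n])
      have h2 := hqp n
      gcongr
    refine hd.mono_of_mem_nhdsWithin ?_
    have h1 : Ioi (r / 2) ∈ nhdsWithin r (Icc 0 1) :=
      mem_nhdsWithin_of_mem_nhds (Ioi_mem_nhds (half_lt_self hr.1))
    filter_upwards [h1, self_mem_nhdsWithin] with t ht ht'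
    exact ⟨le_of_lt ht, ht'.2⟩
  have hquot : Tendsto (fun r => v r / r) (nhdsWithin 0 (Ioc 0 1)) (nhds g0) := by
    have hup : Tendsto (fun r => -(w r ^ p / (lam * (k + 2)))) (nhdsWithin 0 (Ioc 0 1))
        (nhds g0) :=
      (((hwc 0 h0mem).mono Ioc_subset_Icc_self).tendsto.div_const _).neg
    refine tendsto_of_tendsto_of_tendsto_of_le_of_le' tendsto_const_nhds hup ?_ ?_
    · filter_upwards [self_mem_nhdsWithin] with r hr
      have hr' := Ioc_subset_Icc_self hr
      refine le_of_tendsto_of_tendsto' ((hwp 0 h0mem).div_const _).neg ((hv r hr').div_const r)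
        fun n => ?_
      rw [le_div_iff₀ hr.1]
      exact (h n).le_deriv hlam hlL (hq0 n) hr'
    · filter_upwards [self_mem_nhdsWithin] with r hr
      have hr' := Ioc_subset_Icc_self hr
      exact le_of_tendsto_of_tendsto' ((hv r hr').div_const r) ((hwp r hr').div_const _).neg
        fun n => (h n).deriv_le hlam (hq0 n) hr
  have hw0 : ∀ r ∈ Icc (0 : ℝ) 1, 0 ≤ w r := fun r hr =>
    ge_of_tendsto' (hw r hr) fun n => (h n).nonneg r hr
  refine ⟨w, v, g, ⟨hdw, ?_, ?_, hw0, ?_, ?_, hv0, fun r hr => hgG r hr.1⟩, hw 0 h0mem⟩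
  · intro r hr
    rcases hr.1.eq_or_lt with rfl | h'
    · rw [hasDerivWithinAt_iff_tendsto_slope, Icc_sdiff_left]
      rw [show g 0 = g0 from if_pos rfl]
      exact hquot.congr fun r => by simp [slope_def_field, hv0]
    · rw [hgG r h']
      exact hdv r ⟨h', hr.2⟩
  · intro r hr
    rcases hr.1.eq_or_lt with rfl | h'
    · rw [← continuousWithinAt_sdiff_self, Icc_sdiff_left]
      have h1 : Tendsto G (nhdsWithin 0 (Ioc 0 1))
          (nhds (pucciInv lam Lam (-w 0 ^ p - lam * (k + 1) * g0))) :=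
        (continuous_pucciInv.tendsto _).comp
          (((hwc 0 h0mem).mono Ioc_subset_Icc_self).tendsto.neg.sub (hquot.const_mul _))
      have h2 : pucciInv lam Lam (-w 0 ^ p - lam * (k + 1) * g0) = g 0 := by
        have h3 : -w 0 ^ p - lam * (k + 1) * g0 = -(w 0 ^ p / (k + 2)) := by
          rw [hg0]
          field_simp
          ring
        have h4 : 0 ≤ w 0 ^ p := rpow_nonneg (hw0 0 h0mem) _
        rw [h3, pucciInv_of_nonpos hlam hlL (by simpa using by positivity)]
        simp only [hg, if_true, hg0]
        field_simp
      rw [h2] at h1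
      refine h1.congr' ?_
      filter_upwards [self_mem_nhdsWithin] with r hr using (hgG r hr.1).symm
    · have h1 : ContinuousWithinAt G (Icc 0 1) r :=
        continuous_pucciInv.continuousAt.comp_continuousWithinAt
          ((hwc r hr).neg.sub (continuousWithinAt_const.mul
            ((hdv r ⟨h', hr.2⟩).continuousWithinAt.div continuousWithinAt_id h'.ne')))
      refine h1.congr_of_eventuallyEq ?_ (hgG r h')
      filter_upwards [mem_nhdsWithin_of_mem_nhds (Ioi_mem_nhds h')] with t ht using hgG t ht
  · refine tendsto_nhds_unique (hw 1 (right_mem_Icc.2 zero_le_one)) ?_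
    simp only [(h _).zero_right]
    exact tendsto_const_nhds
  · exact fun r hr => le_of_tendsto' (hv r hr) fun n => (h n).nonpos r hr

/-- Blow-up of the maxima: if the Dirichlet problem at the critical exponent `p⋆` has
no positive radial solution, then the maxima `Mₙ = uₙ(0)` of solutions at subcritical
exponents `pₙ = p⋆ − εₙ → p⋆` tend to `+∞`. -/
theorem stmt_3 (lam Lam : ℝ) (N : ℕ) (Ntil pstar : ℝ)
    (hlam : 0 < lam) (hlL : lam ≤ Lam) (hN : 2 ≤ N)
    (hNtil : Ntil = lam / Lam * ((N : ℝ) - 1) + 1) (hNtil2 : 2 < Ntil)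
    (hpstar : 1 < pstar)
    (hnonex : ¬ ∃ w : ℝ → ℝ, IsDirichletSol lam Lam N pstar w)
    (ε : ℕ → ℝ) (hε : ∀ n, 0 < ε n) (hε0 : Tendsto ε atTop (nhds 0))
    (hpn : ∀ n, 1 < pstar - ε n)
    (u : ℕ → ℝ → ℝ) (hu : ∀ n, IsDirichletSol lam Lam N (pstar - ε n) (u n)) :
    Tendsto (fun n => u n 0) atTop atTop := by
  obtain ⟨k, rfl⟩ : ∃ k, N = k + 2 := ⟨N - 2, by omega⟩
  by_contra hcon
  rw [Filter.tendsto_atTop] at hcon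
  push Not at hcon
  obtain ⟨C, hC⟩ := hcon
  obtain ⟨φ, hφ, hφC⟩ := extraction_of_frequently_atTop hC
  choose a b hab using fun n => (hu (φ n)).exists_isRegularSol hlam hlL (hpn (φ n))
  have hq : Tendsto (fun n => pstar - ε (φ n)) atTop (nhds pstar) := by
    simpa using (hε0.comp hφ.tendsto_atTop).const_sub pstar
  obtain ⟨w, v, g, hw, hlim⟩ := exists_isRegularSol_limit (C := max C 1) hlam hlL
    (fun n => (hpn (φ n)).le) (fun n => by linarith [hε (φ n)]) hq (le_max_right _ _)
    (fun n => le_max_of_le_left (hφC n).le) hab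
  refine hnonex ⟨w, hw.isDirichletSol hlam hlL fun r hr => hw.pos_of_pos_left hlam ?_ hr⟩
  have hqh : Tendsto (fun n => pstar - ε (φ n) - 1) (hyperfilter ℕ) (nhds (pstar - 1)) :=
    (hq.mono_left Nat.hyperfilter_le_atTop).sub_const 1
  have hpow := hlim.rpow hqh (Or.inr (by linarith))
  have hge : lam * (k + 2) ≤ w 0 ^ (pstar - 1) := by
    refine ge_of_tendsto' hpow fun n => ?_
    have h0 : 0 < u (φ n) 0 := (hu (φ n)).2.1 0 (by simp)
    have h1 := (hab n).left_le hlam hlL (by linarith [hpn (φ n)])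
    rw [le_div_iff₀ (by positivity)] at h1
    rw [rpow_sub_one h0.ne', le_div_iff₀ h0]
    linarith
  refine (hw.nonneg 0 (by simp)).lt_of_ne fun h0 => ?_
  rw [← h0, zero_rpow (by linarith)] at hge
  have : 0 < lam * ((k : ℝ) + 2) := by positivity
  linarith
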